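/- arXiv:math/0503158 — 7 statements merged into one kernel-verified Lean document; each statement's English description precedes it below -/
import Mathlib

section
/- Let n ≥ 1, let [a,b] be a real interval, and let H, Z : ℝ → Matrix (Fin n) (Fin n) ℝ be continuous on [a,b]; set A(x) = H(x) + Z(x). Suppose y_j : ℝ → (Fin n → ℝ), for j = 0, 1, 2, …, are such that y_0 is differentiable on [a,b] with y_0'(x) = H(x) ·ᵥ y_0(x) on [a,b], and for every j ≥ 1, y_j is differentiable on [a,b] with y_j'(x) = H(x) ·ᵥ y_j(x) + Z(x) ·ᵥ y_{j-1}(x) on [a,b]. If the partial sums S_l(x) = Σ_{k=0}^{l} y_k(x) converge uniformly on [a,b] to a function S : ℝ → (Fin n → ℝ), then S is differentiable on [a,b] and S'(x) = A(x) ·ᵥ S(x) for all x ∈ [a,b]; that is, the sum of the special series is a solution of the homogeneous linear vector differential equation y' = A(x) y on [a,b]. -/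
open Matrix

attribute [local instance] Matrix.normedAddCommGroup Matrix.normedSpace

theorem hasDerivWithinAt_of_unif {E : Type*} [NormedAddCommGroup E] [NormedSpace ℝ E]
    {s : Set ℝ} (hs : Convex ℝ s) (f f' : ℕ → ℝ → E) (F g : ℝ → E)
    (hf : ∀ m, ∀ x ∈ s, HasDerivWithinAt (f m) (f' m x) s x)
    (hF : ∀ x ∈ s, Filter.Tendsto (fun m => f m x) Filter.atTop (nhds (F x)))
    (hg : TendstoUniformlyOn f' g Filter.atTop s) :
    ∀ x ∈ s, HasDerivWithinAt F (g x) s x := by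
  intro x hx
  rw [hasDerivWithinAt_iff_isLittleO, Asymptotics.isLittleO_iff]
  intro ε hε
  rw [Metric.tendstoUniformlyOn_iff] at hg
  obtain ⟨N, hN⟩ := Filter.eventually_atTop.1 (hg (ε / 4) (by positivity))
  have key : ∀ z ∈ s, ‖(F z - f N z) - (F x - f N x)‖ ≤ ε / 2 * ‖z - x‖ := by
    intro z hz
    have hlim : Filter.Tendsto (fun m => ‖(f m z - f N z) - (f m x - f N x)‖) Filter.atTop
        (nhds ‖(F z - f N z) - (F x - f N x)‖) :=
      (((hF z hz).sub_const _).sub ((hF x hx).sub_const _)).norm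
    refine le_of_tendsto hlim (Filter.eventually_atTop.2 ⟨N, fun m hm => ?_⟩)
    refine Convex.norm_image_sub_le_of_norm_hasDerivWithin_le
      (f := fun w => f m w - f N w) (f' := fun w => f' m w - f' N w)
      (fun w hw => (hf m w hw).sub (hf N w hw)) (fun w hw => ?_) hs hx hz
    have h1 := hN m hm w hw
    have h2 := hN N le_rfl w hw
    have h3 := dist_triangle_left (f' m w) (f' N w) (g w)
    rw [← dist_eq_norm]
    linarith
  have hd := hf N x hx
  rw [hasDerivWithinAt_iff_isLittleO, Asymptotics.isLittleO_iff] at hd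
  filter_upwards [hd (show 0 < ε / 4 by positivity), self_mem_nhdsWithin] with z h1 hz
  have h2 := key z hz
  have h3 : ‖(z - x) • (f' N x - g x)‖ ≤ ε / 4 * ‖z - x‖ := by
    rw [norm_smul, mul_comm]
    have := hN N le_rfl x hx
    rw [dist_comm, dist_eq_norm] at this
    gcongr
  have e : F z - F x - (z - x) • g x = ((F z - f N z) - (F x - f N x))
      + (f N z - f N x - (z - x) • f' N x) + (z - x) • (f' N x - g x) := by
    rw [smul_sub]; abel
  rw [e]
  refine (norm_add₃_le).trans ?_
  linarith

theorem mulVec_bound {n : ℕ} {a b : ℝ} (M : ℝ → Matrix (Fin n) (Fin n) ℝ)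
    (hM : ContinuousOn M (Set.Icc a b)) :
    ∃ K : ℝ, 0 < K ∧ ∀ x ∈ Set.Icc a b, ∀ v : Fin n → ℝ, ‖M x *ᵥ v‖ ≤ K * ‖v‖ := by
  obtain ⟨C, hC⟩ := isCompact_Icc.exists_bound_of_continuousOn hM
  refine ⟨n * |C| + 1, by positivity, fun x hx v => ?_⟩
  have hx' : ‖M x‖ ≤ |C| := (hC x hx).trans (le_abs_self C)
  rw [pi_norm_le_iff_of_nonneg (by positivity)]
  intro i
  have h1 : ‖(M x *ᵥ v) i‖ ≤ ∑ j : Fin n, |C| * ‖v‖ := by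
    rw [Matrix.mulVec, dotProduct]
    refine norm_sum_le_of_le _ fun j _ => ?_
    rw [norm_mul]
    exact mul_le_mul ((Matrix.norm_entry_le_entrywise_sup_norm (M x)).trans hx')
      (norm_le_pi_norm v j) (norm_nonneg _) (abs_nonneg _)
  simp only [Finset.sum_const, Finset.card_univ, Fintype.card_fin, nsmul_eq_mul] at h1
  have := norm_nonneg v
  linarith

theorem mulVec_unif {n : ℕ} {a b : ℝ} (M : ℝ → Matrix (Fin n) (Fin n) ℝ)
    (hM : ContinuousOn M (Set.Icc a b)) (f : ℕ → ℝ → Fin n → ℝ) (F : ℝ → Fin n → ℝ)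
    (h : TendstoUniformlyOn f F Filter.atTop (Set.Icc a b)) :
    TendstoUniformlyOn (fun m x => M x *ᵥ f m x) (fun x => M x *ᵥ F x)
      Filter.atTop (Set.Icc a b) := by
  obtain ⟨K, hK, hb⟩ := mulVec_bound M hM
  rw [Metric.tendstoUniformlyOn_iff] at h ⊢
  intro ε hε
  filter_upwards [h (ε / K) (by positivity)] with m hm x hx
  have h1 := hm x hx
  rw [dist_eq_norm] at h1 ⊢
  rw [← Matrix.mulVec_sub]
  refine (hb x hx _).trans_lt ?_
  rw [lt_div_iff₀ hK] at h1
  linarith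

/-- If `H` and `Z` are continuous on `[a,b]`, the terms of the special series satisfy
the recursion `y₀' = H y₀`, `yⱼ' = H yⱼ + Z yⱼ₋₁` on `[a,b]`, and the partial sums
`S_l = ∑_{k=0}^l y_k` converge uniformly on `[a,b]` to `S`, then `S` is differentiable
on `[a,b]` and solves the homogeneous equation `S' = (H + Z) S` there. -/
theorem special_series_sum_solves_homogeneous
    (n : ℕ) (hn : 1 ≤ n) (a b : ℝ)
    (H Z : ℝ → Matrix (Fin n) (Fin n) ℝ)
    (hH : ContinuousOn H (Set.Icc a b))
    (hZ : ContinuousOn Z (Set.Icc a b))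
    (y : ℕ → ℝ → (Fin n → ℝ))
    (h0 : ∀ x ∈ Set.Icc a b,
      HasDerivWithinAt (y 0) (H x *ᵥ y 0 x) (Set.Icc a b) x)
    (hrec : ∀ j : ℕ, 1 ≤ j → ∀ x ∈ Set.Icc a b,
      HasDerivWithinAt (y j) (H x *ᵥ y j x + Z x *ᵥ y (j - 1) x) (Set.Icc a b) x)
    (S : ℝ → (Fin n → ℝ))
    (hconv : TendstoUniformlyOn
      (fun l x => ∑ k ∈ Finset.range (l + 1), y k x) S Filter.atTop (Set.Icc a b)) :
    ∀ x ∈ Set.Icc a b,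
      HasDerivWithinAt S ((H x + Z x) *ᵥ S x) (Set.Icc a b) x := by
  have hconv1 : TendstoUniformlyOn
      (fun l x => ∑ k ∈ Finset.range (l + 1 + 1), y k x) S Filter.atTop (Set.Icc a b) :=
    fun u hu => (Filter.tendsto_add_atTop_nat 1).eventually (hconv u hu)
  have hder : ∀ l : ℕ, ∀ x ∈ Set.Icc a b,
      HasDerivWithinAt (fun x => ∑ k ∈ Finset.range (l + 1 + 1), y k x)
        (H x *ᵥ (∑ k ∈ Finset.range (l + 1 + 1), y k x)
          + Z x *ᵥ (∑ k ∈ Finset.range (l + 1), y k x)) (Set.Icc a b) x := by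
    intro l x hx
    induction l with
    | zero =>
      have h := (h0 x hx).add (hrec 1 le_rfl x hx)
      simp only [Finset.sum_range_succ, Finset.sum_range_zero, zero_add]
      refine h.congr_deriv ?_
      simp only [Matrix.mulVec_add, Nat.sub_self]
      abel
    | succ l ih =>
      have h := ih.add (hrec (l + 1 + 1) (by omega) x hx)
      simp only [Finset.sum_range_succ _ (l + 1 + 1)]
      refine h.congr_deriv ?_
      rw [Finset.sum_range_succ _ (l + 1), Nat.add_sub_cancel]
      simp only [Matrix.mulVec_add]
      abel
  intro x hx
  rw [Matrix.add_mulVec]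
  exact hasDerivWithinAt_of_unif (convex_Icc a b) _ _ S (fun x => H x *ᵥ S x + Z x *ᵥ S x) hder
    (fun x hx => hconv1.tendsto_at hx)
    ((mulVec_unif H hH _ S hconv1).add (mulVec_unif Z hZ _ S hconv)) x hx
end

section
/- Let n ≥ 1, let [a,b] be a real interval, let H, Z : ℝ → Matrix (Fin n) (Fin n) ℝ be continuous on [a,b], let F : ℝ → (Fin n → ℝ), and set A(x) = H(x) + Z(x). Suppose y_j : ℝ → (Fin n → ℝ), for j = 0, 1, 2, …, are such that y_0 is differentiable on [a,b] with y_0'(x) = H(x) ·ᵥ y_0(x) + F(x) on [a,b], and for every j ≥ 1, y_j is differentiable on [a,b] with y_j'(x) = H(x) ·ᵥ y_j(x) + Z(x) ·ᵥ y_{j-1}(x) on [a,b]. If the partial sums S_l(x) = Σ_{k=0}^{l} y_k(x) converge uniformly on [a,b] to a function S : ℝ → (Fin n → ℝ), then S is differentiable on [a,b] and S'(x) = A(x) ·ᵥ S(x) + F(x) for all x ∈ [a,b]; that is, the sum of the special series is a solution of the nonhomogeneous linear vector differential equation y' = A(x) y + F(x) on [a,b]. -/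
open Matrix

/-- Uniform convergence of derivatives on a convex set, one-sided version. -/
theorem hasDerivWithinAt_of_tendstoUniformlyOn_aux {E : Type*} [NormedAddCommGroup E]
    [NormedSpace ℝ E] {s : Set ℝ} (hs : Convex ℝ s) {f g : ℕ → ℝ → E} {S G : ℝ → E}
    (hf : ∀ l, ∀ x ∈ s, HasDerivWithinAt (f l) (g l x) s x)
    (hS : ∀ x ∈ s, Filter.Tendsto (fun l => f l x) Filter.atTop (nhds (S x)))
    (hg : TendstoUniformlyOn g G Filter.atTop s) :
    ∀ x ∈ s, HasDerivWithinAt S (G x) s x := by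
  intro x hx
  rw [hasDerivWithinAt_iff_isLittleO, Asymptotics.isLittleO_iff]
  intro c hc
  rw [Metric.tendstoUniformlyOn_iff] at hg
  obtain ⟨N, hN⟩ := Filter.eventually_atTop.1 (hg (c / 4) (by positivity))
  have hfN := hf N x hx
  rw [hasDerivWithinAt_iff_isLittleO, Asymptotics.isLittleO_iff] at hfN
  have h1 := hfN (show (0 : ℝ) < c / 4 by positivity)
  filter_upwards [h1, self_mem_nhdsWithin] with z hz hzs
  have h2 : ‖(S z - f N z) - (S x - f N x)‖ ≤ c / 2 * ‖z - x‖ := by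
    have ht : Filter.Tendsto (fun m => ‖(f m z - f N z) - (f m x - f N x)‖) Filter.atTop
        (nhds ‖(S z - f N z) - (S x - f N x)‖) :=
      (((hS z hzs).sub_const _).sub ((hS x hx).sub_const _)).norm
    refine le_of_tendsto ht (Filter.eventually_atTop.2 ⟨N, fun m hm => ?_⟩)
    refine hs.norm_image_sub_le_of_norm_hasDerivWithin_le (f := fun t => f m t - f N t)
      (f' := fun t => g m t - g N t) (fun t ht => (hf m t ht).sub (hf N t ht)) ?_ hx hzs
    intro t ht
    have e1 := hN m hm t ht
    have e2 := hN N le_rfl t ht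
    have e3 := dist_triangle_left (g m t) (g N t) (G t)
    rw [← dist_eq_norm]
    linarith
  have h3 : ‖g N x - G x‖ ≤ c / 4 := by
    have := hN N le_rfl x hx
    rw [dist_comm, dist_eq_norm] at this
    exact this.le
  have h4 : ‖(z - x) • (g N x - G x)‖ ≤ c / 4 * ‖z - x‖ := by
    rw [norm_smul, mul_comm]
    gcongr
  have h5 : S z - S x - (z - x) • G x = ((S z - f N z) - (S x - f N x))
      + (f N z - f N x - (z - x) • g N x) + (z - x) • (g N x - G x) := by
    rw [smul_sub]; abel
  rw [h5]
  refine (norm_add₃_le).trans ?_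
  linarith

attribute [local instance] Matrix.linftyOpNormedAddCommGroup in
/-- A continuous matrix function on a compact interval preserves uniform convergence. -/
theorem tendstoUniformlyOn_mulVec_aux {n : ℕ} {a b : ℝ} {H : ℝ → Matrix (Fin n) (Fin n) ℝ}
    (hH : ContinuousOn H (Set.Icc a b)) {f : ℕ → ℝ → (Fin n → ℝ)} {S : ℝ → (Fin n → ℝ)}
    (hf : TendstoUniformlyOn f S Filter.atTop (Set.Icc a b)) :
    TendstoUniformlyOn (fun l x => H x *ᵥ f l x) (fun x => H x *ᵥ S x)
      Filter.atTop (Set.Icc a b) := by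
  obtain ⟨C, hC⟩ := isCompact_Icc.exists_bound_of_continuousOn hH
  rw [Metric.tendstoUniformlyOn_iff] at hf ⊢
  intro ε hε
  have hp : 0 < |C| + 1 := by positivity
  filter_upwards [hf (ε / (|C| + 1)) (by positivity)] with l hl x hx
  have h1 := hl x hx
  rw [dist_eq_norm] at h1 ⊢
  rw [← Matrix.mulVec_sub]
  refine (Matrix.linfty_opNorm_mulVec _ _).trans_lt ?_
  rw [lt_div_iff₀ hp] at h1
  have h2 : ‖H x‖ ≤ |C| + 1 := (hC x hx).trans (by linarith [le_abs_self C])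
  calc ‖H x‖ * ‖S x - f l x‖ ≤ (|C| + 1) * ‖S x - f l x‖ := by gcongr
    _ < ε := by linarith

/-- If `H` and `Z` are continuous on `[a,b]`, the terms of the special series satisfy
the recursion `y₀' = H y₀ + F`, `yⱼ' = H yⱼ + Z yⱼ₋₁` on `[a,b]`, and the partial sums
`S_l = ∑_{k=0}^l y_k` converge uniformly on `[a,b]` to `S`, then `S` is differentiable
on `[a,b]` and solves the nonhomogeneous equation `S' = (H + Z) S + F` there. -/
theorem special_series_sum_solves_nonhomogeneous
    (n : ℕ) (hn : 1 ≤ n) (a b : ℝ)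
    (H Z : ℝ → Matrix (Fin n) (Fin n) ℝ)
    (hH : ContinuousOn H (Set.Icc a b))
    (hZ : ContinuousOn Z (Set.Icc a b))
    (F : ℝ → (Fin n → ℝ))
    (y : ℕ → ℝ → (Fin n → ℝ))
    (h0 : ∀ x ∈ Set.Icc a b,
      HasDerivWithinAt (y 0) (H x *ᵥ y 0 x + F x) (Set.Icc a b) x)
    (hrec : ∀ j : ℕ, 1 ≤ j → ∀ x ∈ Set.Icc a b,
      HasDerivWithinAt (y j) (H x *ᵥ y j x + Z x *ᵥ y (j - 1) x) (Set.Icc a b) x)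
    (S : ℝ → (Fin n → ℝ))
    (hconv : TendstoUniformlyOn
      (fun l x => ∑ k ∈ Finset.range (l + 1), y k x) S Filter.atTop (Set.Icc a b)) :
    ∀ x ∈ Set.Icc a b,
      HasDerivWithinAt S ((H x + Z x) *ᵥ S x + F x) (Set.Icc a b) x := by
  have hshift : TendstoUniformlyOn
      (fun l x => ∑ k ∈ Finset.range (l + 1 + 1), y k x) S Filter.atTop (Set.Icc a b) :=
    fun u hu => (Filter.tendsto_add_atTop_nat 1).eventually (hconv u hu)
  have hder : ∀ l : ℕ, ∀ x ∈ Set.Icc a b,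
      HasDerivWithinAt (fun x => ∑ k ∈ Finset.range (l + 1 + 1), y k x)
        (H x *ᵥ (∑ k ∈ Finset.range (l + 1 + 1), y k x)
          + Z x *ᵥ (∑ k ∈ Finset.range (l + 1), y k x) + F x) (Set.Icc a b) x := by
    intro l x hx
    induction l with
    | zero =>
      have h := (h0 x hx).add (hrec 1 le_rfl x hx)
      simp only [Finset.sum_range_succ, Finset.sum_range_zero, zero_add]
      refine h.congr_deriv ?_
      simp only [Matrix.mulVec_add, Nat.sub_self]
      abel
    | succ l ih =>
      have h := ih.add (hrec (l + 1 + 1) (by omega) x hx)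
      have e : (fun x => ∑ k ∈ Finset.range (l + 1 + 1 + 1), y k x)
          = (fun x => ∑ k ∈ Finset.range (l + 1 + 1), y k x) + y (l + 1 + 1) := by
        funext t
        rw [Finset.sum_range_succ]; rfl
      rw [e]
      refine h.congr_deriv ?_
      rw [Finset.sum_range_succ _ (l + 1 + 1), Matrix.mulVec_add,
        Finset.sum_range_succ _ (l + 1), Matrix.mulVec_add (Z x), Nat.add_sub_cancel]
      abel
  refine hasDerivWithinAt_of_tendstoUniformlyOn_aux (convex_Icc a b) hder
    (fun x hx => hshift.tendsto_at hx) ?_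
  have hu := (tendstoUniformlyOn_mulVec_aux hH hshift).add (tendstoUniformlyOn_mulVec_aux hZ hconv)
  rw [Metric.tendstoUniformlyOn_iff] at hu ⊢
  intro ε hε
  filter_upwards [hu ε hε] with l hl x hx
  rw [Matrix.add_mulVec, dist_add_right]
  exact hl x hx
end

section
/- Let n ≥ 1, let [a,b] be a real interval, let H : ℝ → Matrix (Fin n) (Fin n) ℝ be continuous on [a,b], and let M : ℝ → Matrix (Fin n) (Fin n) ℝ be differentiable on [a,b] with M'(x) = H(x) * M(x) and M(x) invertible for every x ∈ [a,b]. Let g : ℝ → (Fin n → ℝ) be continuous on [a,b] and let x₀ ∈ [a,b]. Then the function Φ(x) = M(x) ·ᵥ ∫_{x₀}^{x} (M(t))⁻¹ ·ᵥ g(t) dt is differentiable on [a,b] and satisfies Φ'(x) = H(x) ·ᵥ Φ(x) + g(x) for all x ∈ [a,b]. -/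
open Matrix

attribute [local instance] Matrix.normedAddCommGroup Matrix.normedSpace

/-- Variation of parameters: if `M` is a fundamental matrix of `y' = H(x) y` on `[a,b]`
(i.e. `M' = H M` with `M(x)` invertible for all `x ∈ [a,b]`), `g` is continuous on
`[a,b]`, and `x₀ ∈ [a,b]`, then `Φ(x) = M(x) ·ᵥ ∫_{x₀}^{x} M(t)⁻¹ ·ᵥ g(t) dt` is
differentiable on `[a,b]` and satisfies `Φ' = H Φ + g` there. -/
theorem variation_of_parameters
    (n : ℕ) (hn : 1 ≤ n) (a b : ℝ)
    (H : ℝ → Matrix (Fin n) (Fin n) ℝ)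
    (hH : ContinuousOn H (Set.Icc a b))
    (M : ℝ → Matrix (Fin n) (Fin n) ℝ)
    (hM : ∀ x ∈ Set.Icc a b, HasDerivWithinAt M (H x * M x) (Set.Icc a b) x)
    (hMinv : ∀ x ∈ Set.Icc a b, IsUnit (M x))
    (g : ℝ → (Fin n → ℝ))
    (hg : ContinuousOn g (Set.Icc a b))
    (x₀ : ℝ) (hx₀ : x₀ ∈ Set.Icc a b) :
    ∀ x ∈ Set.Icc a b,
      HasDerivWithinAt (fun x => M x *ᵥ ∫ t in x₀..x, (M t)⁻¹ *ᵥ g t)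
        (H x *ᵥ (M x *ᵥ ∫ t in x₀..x, (M t)⁻¹ *ᵥ g t) + g x)
        (Set.Icc a b) x := by
  intro x hx
  have hMc : ContinuousOn M (Set.Icc a b) := fun y hy => (hM y hy).continuousWithinAt
  have hinv : ContinuousOn (fun t => (M t)⁻¹) (Set.Icc a b) := by
    have h1 : ContinuousOn (fun t => (M t).det) (Set.Icc a b) :=
      (continuous_id.matrix_det).comp_continuousOn hMc
    have h2 : ContinuousOn (fun t => (M t).adjugate) (Set.Icc a b) :=
      (continuous_id.matrix_adjugate).comp_continuousOn hMc
    have h3 : ContinuousOn (fun t => ((M t).det)⁻¹) (Set.Icc a b) :=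
      h1.inv₀ fun t ht => ((Matrix.isUnit_iff_isUnit_det _).1 (hMinv t ht)).ne_zero
    have h4 := h3.smul h2
    refine h4.congr fun t _ => ?_
    simp [Matrix.inv_def, Ring.inverse_eq_inv]
  have hf : ContinuousOn (fun t => (M t)⁻¹ *ᵥ g t) (Set.Icc a b) :=
    (continuous_fst.matrix_mulVec continuous_snd).comp_continuousOn (hinv.prodMk hg)
  have hF : HasDerivWithinAt (fun u => ∫ t in x₀..u, (M t)⁻¹ *ᵥ g t)
      ((M x)⁻¹ *ᵥ g x) (Set.Icc a b) x := by
    haveI : Fact (x ∈ Set.Icc a b) := ⟨hx⟩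
    refine intervalIntegral.integral_hasDerivWithinAt_right (t := Set.Icc a b) ?_ ?_ (hf x hx)
    · exact (hf.mono (Set.uIcc_subset_Icc hx₀ hx)).intervalIntegrable
    · exact hf.stronglyMeasurableAtFilter_nhdsWithin measurableSet_Icc x
  have hMx : ∀ i j, HasDerivWithinAt (fun u => M u i j) ((H x * M x) i j) (Set.Icc a b) x :=
    fun i j => hasDerivWithinAt_pi.1 (hasDerivWithinAt_pi.1 (hM x hx) i) j
  have hFx := hasDerivWithinAt_pi.1 hF
  have hcancel : M x *ᵥ ((M x)⁻¹ *ᵥ g x) = g x := by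
    rw [Matrix.mulVec_mulVec, Matrix.mul_nonsing_inv _
      ((Matrix.isUnit_iff_isUnit_det _).1 (hMinv x hx)), Matrix.one_mulVec]
  rw [Matrix.mulVec_mulVec]
  conv => arg 2; rw [← hcancel]
  refine hasDerivWithinAt_pi.2 fun i => ?_
  have := HasDerivWithinAt.fun_sum (u := Finset.univ) fun j _ => (hMx i j).mul (hFx j)
  refine this.congr_deriv ?_
  rw [Finset.sum_add_distrib]
  rfl
end

section
/- Let n ≥ 1, let [a,b] be a real interval, let H, Z : ℝ → Matrix (Fin n) (Fin n) ℝ be continuous on [a,b], and let M : ℝ → Matrix (Fin n) (Fin n) ℝ be differentiable on [a,b] with M'(x) = H(x) * M(x) and M(x) invertible for every x ∈ [a,b]. Fix x₀ ∈ [a,b] and a constant vector c ∈ (Fin n → ℝ), and define the sequence Φ_j : ℝ → (Fin n → ℝ) recursively by Φ_0(x) = M(x) ·ᵥ c and Φ_{j+1}(x) = M(x) ·ᵥ ∫_{x₀}^{x} (M(t))⁻¹ ·ᵥ (Z(t) ·ᵥ Φ_j(t)) dt. Then Φ_0 is differentiable on [a,b] with Φ_0'(x) = H(x) ·ᵥ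 Φ_0(x), and for every j ≥ 0, Φ_{j+1} is differentiable on [a,b] with Φ_{j+1}'(x) = H(x) ·ᵥ Φ_{j+1}(x) + Z(x) ·ᵥ Φ_j(x) for all x ∈ [a,b]. -/
open Matrix

attribute [local instance] Matrix.normedAddCommGroup Matrix.normedSpace

theorem hasDerivWithinAt_mulVec_aux {n : ℕ} {s : Set ℝ} {x : ℝ}
    {M : ℝ → Matrix (Fin n) (Fin n) ℝ} {M' : Matrix (Fin n) (Fin n) ℝ}
    {v : ℝ → Fin n → ℝ} {v' : Fin n → ℝ}
    (hM : HasDerivWithinAt M M' s x) (hv : HasDerivWithinAt v v' s x) :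
    HasDerivWithinAt (fun t => M t *ᵥ v t) (M' *ᵥ v x + M x *ᵥ v') s x := by
  have hM2 : ∀ i j, HasDerivWithinAt (fun t => M t i j) (M' i j) s x := fun i j =>
    hasDerivWithinAt_pi.1 (hasDerivWithinAt_pi.1 hM i) j
  have hv2 := hasDerivWithinAt_pi.1 hv
  refine hasDerivWithinAt_pi.2 fun i => ?_
  have h := HasDerivWithinAt.fun_sum (u := Finset.univ)
    (fun j _ => (hM2 i j).mul (hv2 j))
  simpa [Matrix.mulVec, dotProduct, Finset.sum_add_distrib] using h

theorem continuousOn_mulVec_aux {n : ℕ} {s : Set ℝ}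
    {M : ℝ → Matrix (Fin n) (Fin n) ℝ} {v : ℝ → Fin n → ℝ}
    (hM : ContinuousOn M s) (hv : ContinuousOn v s) :
    ContinuousOn (fun t => M t *ᵥ v t) s := by
  rw [continuousOn_iff_continuous_restrict] at *
  exact Continuous.matrix_mulVec hM hv

theorem continuousOn_inv_aux {n : ℕ} {s : Set ℝ}
    {M : ℝ → Matrix (Fin n) (Fin n) ℝ}
    (hM : ContinuousOn M s) (hu : ∀ x ∈ s, IsUnit (M x)) :
    ContinuousOn (fun t => (M t)⁻¹) s := by
  have hd : ContinuousOn (fun t => (M t).det) s := by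
    rw [continuousOn_iff_continuous_restrict] at *
    exact Continuous.matrix_det hM
  have ha : ContinuousOn (fun t => (M t).adjugate) s := by
    rw [continuousOn_iff_continuous_restrict] at *
    exact Continuous.matrix_adjugate hM
  have : ContinuousOn (fun t => ((M t).det)⁻¹ • (M t).adjugate) s :=
    (hd.inv₀ fun x hx => ((Matrix.isUnit_iff_isUnit_det _).1 (hu x hx)).ne_zero).smul ha
  simpa [Matrix.inv_def] using this

/-- If `M` is a fundamental matrix of `y' = H(x) y` on `[a,b]` and the terms of the
special series are defined by `Φ₀(x) = M(x) c` and
`Φ_{j+1}(x) = M(x) ·ᵥ ∫_{x₀}^{x} M(t)⁻¹ ·ᵥ (Z(t) ·ᵥ Φ_j(t)) dt`, then `Φ₀' = H Φ₀`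
and `Φ_{j+1}' = H Φ_{j+1} + Z Φ_j` on `[a,b]` for every `j ≥ 0`. -/
theorem special_series_terms_solve_recursion
    (n : ℕ) (hn : 1 ≤ n) (a b : ℝ)
    (H Z : ℝ → Matrix (Fin n) (Fin n) ℝ)
    (hH : ContinuousOn H (Set.Icc a b))
    (hZ : ContinuousOn Z (Set.Icc a b))
    (M : ℝ → Matrix (Fin n) (Fin n) ℝ)
    (hM : ∀ x ∈ Set.Icc a b, HasDerivWithinAt M (H x * M x) (Set.Icc a b) x)
    (hMinv : ∀ x ∈ Set.Icc a b, IsUnit (M x))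
    (x₀ : ℝ) (hx₀ : x₀ ∈ Set.Icc a b)
    (c : Fin n → ℝ)
    (Φ : ℕ → ℝ → (Fin n → ℝ))
    (hΦ0 : ∀ x : ℝ, Φ 0 x = M x *ᵥ c)
    (hΦrec : ∀ (j : ℕ) (x : ℝ),
      Φ (j + 1) x = M x *ᵥ ∫ t in x₀..x, (M t)⁻¹ *ᵥ (Z t *ᵥ Φ j t)) :
    (∀ x ∈ Set.Icc a b,
      HasDerivWithinAt (Φ 0) (H x *ᵥ Φ 0 x) (Set.Icc a b) x) ∧
    (∀ (j : ℕ), ∀ x ∈ Set.Icc a b,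
      HasDerivWithinAt (Φ (j + 1))
        (H x *ᵥ Φ (j + 1) x + Z x *ᵥ Φ j x) (Set.Icc a b) x) := by
  have hMc : ContinuousOn M (Set.Icc a b) := fun x hx => (hM x hx).continuousWithinAt
  have h0 : ∀ x ∈ Set.Icc a b,
      HasDerivWithinAt (Φ 0) (H x *ᵥ Φ 0 x) (Set.Icc a b) x := by
    intro x hx
    have h := hasDerivWithinAt_mulVec_aux (hM x hx) (hasDerivWithinAt_const x (Set.Icc a b) c)
    rw [funext hΦ0]
    simpa [Matrix.mulVec_mulVec] using h
  have hstep : ∀ j, ContinuousOn (Φ j) (Set.Icc a b) → ∀ x ∈ Set.Icc a b,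
      HasDerivWithinAt (Φ (j + 1))
        (H x *ᵥ Φ (j + 1) x + Z x *ᵥ Φ j x) (Set.Icc a b) x := by
    intro j hj x hx
    have hf : ContinuousOn (fun t => (M t)⁻¹ *ᵥ (Z t *ᵥ Φ j t)) (Set.Icc a b) :=
      continuousOn_mulVec_aux (continuousOn_inv_aux hMc hMinv) (continuousOn_mulVec_aux hZ hj)
    have hint : IntervalIntegrable (fun t => (M t)⁻¹ *ᵥ (Z t *ᵥ Φ j t))
        MeasureTheory.volume x₀ x :=
      (hf.mono (Set.uIcc_subset_Icc hx₀ hx)).intervalIntegrable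
    haveI : Fact (x ∈ Set.Icc a b) := ⟨hx⟩
    have hI := intervalIntegral.integral_hasDerivWithinAt_right hint
      (s := Set.Icc a b) (t := Set.Icc a b)
      (hf.stronglyMeasurableAtFilter_nhdsWithin measurableSet_Icc x) (hf x hx)
    have h := hasDerivWithinAt_mulVec_aux (hM x hx) hI
    have hdet := (Matrix.isUnit_iff_isUnit_det _).1 (hMinv x hx)
    rw [funext (hΦrec j)]
    convert h using 1
    simp only [Matrix.mulVec_mulVec, ← Matrix.mul_assoc, Matrix.mul_nonsing_inv _ hdet,
      Matrix.one_mul]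
  have hc : ∀ j, ContinuousOn (Φ j) (Set.Icc a b) := by
    intro j
    induction j with
    | zero => exact fun x hx => (h0 x hx).continuousWithinAt
    | succ k ih => exact fun x hx => (hstep k ih x hx).continuousWithinAt
  exact ⟨h0, fun j => hstep j (hc j)⟩
end

section
/- Let n ≥ 1, let [a,b] be a real interval, let H, Z : ℝ → Matrix (Fin n) (Fin n) ℝ be continuous on [a,b], and let M : ℝ → Matrix (Fin n) (Fin n) ℝ be differentiable on [a,b] with M'(x) = H(x) * M(x) and M(x) invertible for every x ∈ [a,b]. Fix x₀ ∈ [a,b] and a constant vector c ∈ (Fin n → ℝ), and define Φ_j : ℝ → (Fin n → ℝ) recursively by Φ_0(x) = M(x) ·ᵥ c and Φ_{j+1}(x) = M(x) ·ᵥ ∫_{x₀}^{x} (M(t))⁻¹ ·ᵥ (Z(t) ·ᵥ Φ_j(t)) dt. If the partial sums Σ_{j=0}^{l} Φ_j converge uniformly on [a,b] to a function Φ̃ : ℝ → (Fin n → ℝ), then Φ̃ is differentiable on [a,b] and Φ̃'(x) = (H(x) + Z(x)) ·ᵥ Φ̃(x) for all x ∈ [a,b]. -/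
open Matrix

attribute [local instance] Matrix.normedAddCommGroup Matrix.normedSpace

theorem aux_norm_mulVec {n : ℕ} (A : Matrix (Fin n) (Fin n) ℝ) (v : Fin n → ℝ) :
    ‖A *ᵥ v‖ ≤ n * ‖A‖ * ‖v‖ := by
  rw [pi_norm_le_iff_of_nonneg (by positivity)]
  intro i
  calc ‖(A *ᵥ v) i‖ = ‖∑ j, A i j * v j‖ := rfl
    _ ≤ ∑ j, ‖A i j * v j‖ := norm_sum_le _ _
    _ ≤ ∑ _j : Fin n, ‖A‖ * ‖v‖ := by
        apply Finset.sum_le_sum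
        intro j _
        rw [norm_mul]
        exact mul_le_mul (Matrix.norm_entry_le_entrywise_sup_norm A) (norm_le_pi_norm v j)
          (norm_nonneg _) (norm_nonneg _)
    _ = n * ‖A‖ * ‖v‖ := by simp [mul_assoc]

theorem aux_deriv_mulVec {n : ℕ} {M : ℝ → Matrix (Fin n) (Fin n) ℝ} {v : ℝ → Fin n → ℝ}
    {M' : Matrix (Fin n) (Fin n) ℝ} {v' : Fin n → ℝ} {s : Set ℝ} {x : ℝ}
    (hM : HasDerivWithinAt M M' s x) (hv : HasDerivWithinAt v v' s x) :
    HasDerivWithinAt (fun t => M t *ᵥ v t) (M' *ᵥ v x + M x *ᵥ v') s x := by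
  rw [hasDerivWithinAt_pi] at hv ⊢
  have hM1 : ∀ i, HasDerivWithinAt (fun t => M t i) (M' i) s x := hasDerivWithinAt_pi.1 hM
  have hM2 : ∀ i j, HasDerivWithinAt (fun t => M t i j) (M' i j) s x :=
    fun i => hasDerivWithinAt_pi.1 (hM1 i)
  intro i
  have := HasDerivWithinAt.fun_sum (u := Finset.univ) (fun j _ => (hM2 i j).mul (hv j))
  rw [Finset.sum_add_distrib] at this
  exact this

theorem aux_cont_inv {n : ℕ} {M : ℝ → Matrix (Fin n) (Fin n) ℝ} {s : Set ℝ}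
    (hM : ContinuousOn M s) (hu : ∀ x ∈ s, IsUnit (M x)) :
    ContinuousOn (fun x => (M x)⁻¹) s := by
  have hdet : ContinuousOn (fun x => (M x).det) s :=
    (Continuous.matrix_det continuous_id).comp_continuousOn hM
  have hadj : ContinuousOn (fun x => (M x).adjugate) s :=
    (Continuous.matrix_adjugate continuous_id).comp_continuousOn hM
  have h : ContinuousOn (fun x => ((M x).det)⁻¹ • (M x).adjugate) s := by
    refine ContinuousOn.smul (hdet.inv₀ ?_) hadj
    intro x hx
    exact ((Matrix.isUnit_iff_isUnit_det _).1 (hu x hx)).ne_zero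
  refine h.congr ?_
  intro x hx
  simp [Matrix.inv_def, Ring.inverse_eq_inv']

theorem aux_cont_mulVec {n : ℕ} {M : ℝ → Matrix (Fin n) (Fin n) ℝ} {v : ℝ → Fin n → ℝ}
    {s : Set ℝ} (hM : ContinuousOn M s) (hv : ContinuousOn v s) :
    ContinuousOn (fun x => M x *ᵥ v x) s := by
  have : Continuous (fun p : Matrix (Fin n) (Fin n) ℝ × (Fin n → ℝ) => p.1 *ᵥ p.2) :=
    continuous_fst.matrix_mulVec continuous_snd
  exact this.comp_continuousOn (hM.prodMk hv)

theorem aux_deriv_integral {n : ℕ} {a b x₀ : ℝ} (hx₀ : x₀ ∈ Set.Icc a b) {g : ℝ → Fin n → ℝ}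
    (hg : ContinuousOn g (Set.Icc a b)) {x : ℝ} (hx : x ∈ Set.Icc a b) :
    HasDerivWithinAt (fun u => ∫ t in x₀..u, g t) (g x) (Set.Icc a b) x := by
  have : Fact (x ∈ Set.Icc a b) := ⟨hx⟩
  exact intervalIntegral.integral_hasDerivWithinAt_right
    ((hg.mono (Set.uIcc_subset_Icc hx₀ hx)).intervalIntegrable)
    (hg.stronglyMeasurableAtFilter_nhdsWithin measurableSet_Icc x) (hg x hx)

/-- If `M` is a fundamental matrix of `y' = H(x) y` on `[a,b]`, the special series has
terms `Φ₀(x) = M(x) c` and `Φ_{j+1}(x) = M(x) ·ᵥ ∫_{x₀}^{x} M(t)⁻¹ ·ᵥ (Z(t) ·ᵥ Φ_j(t)) dt`,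
and the partial sums `∑_{j=0}^{l} Φ_j` converge uniformly on `[a,b]` to `Φ̃`, then `Φ̃`
is differentiable on `[a,b]` and solves the homogeneous equation
`Φ̃' = (H + Z) Φ̃` there. -/
theorem special_series_solution_homogeneous
    (n : ℕ) (hn : 1 ≤ n) (a b : ℝ)
    (H Z : ℝ → Matrix (Fin n) (Fin n) ℝ)
    (hH : ContinuousOn H (Set.Icc a b))
    (hZ : ContinuousOn Z (Set.Icc a b))
    (M : ℝ → Matrix (Fin n) (Fin n) ℝ)
    (hM : ∀ x ∈ Set.Icc a b, HasDerivWithinAt M (H x * M x) (Set.Icc a b) x)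
    (hMinv : ∀ x ∈ Set.Icc a b, IsUnit (M x))
    (x₀ : ℝ) (hx₀ : x₀ ∈ Set.Icc a b)
    (c : Fin n → ℝ)
    (Φ : ℕ → ℝ → (Fin n → ℝ))
    (hΦ0 : ∀ x : ℝ, Φ 0 x = M x *ᵥ c)
    (hΦrec : ∀ (j : ℕ) (x : ℝ),
      Φ (j + 1) x = M x *ᵥ ∫ t in x₀..x, (M t)⁻¹ *ᵥ (Z t *ᵥ Φ j t))
    (Φt : ℝ → (Fin n → ℝ))
    (hconv : TendstoUniformlyOn
      (fun l x => ∑ j ∈ Finset.range (l + 1), Φ j x) Φt Filter.atTop (Set.Icc a b)) :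
    ∀ x ∈ Set.Icc a b,
      HasDerivWithinAt Φt ((H x + Z x) *ᵥ Φt x) (Set.Icc a b) x := by
  have hMc : ContinuousOn M (Set.Icc a b) := fun x hx => (hM x hx).continuousWithinAt
  have hMi := aux_cont_inv hMc hMinv
  set G : ℝ → Matrix (Fin n) (Fin n) ℝ := fun t => (M t)⁻¹ * Z t with hG
  have hGc : ContinuousOn G (Set.Icc a b) := by
    have : Continuous (fun p : Matrix (Fin n) (Fin n) ℝ × Matrix (Fin n) (Fin n) ℝ =>
        p.1 * p.2) := continuous_fst.matrix_mul continuous_snd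
    exact this.comp_continuousOn (hMi.prodMk hZ)
  have hrec : ∀ j x, Φ (j + 1) x = M x *ᵥ ∫ t in x₀..x, G t *ᵥ Φ j t := by
    intro j x
    simp only [hΦrec, hG, Matrix.mulVec_mulVec]
  have hΦc : ∀ j, ContinuousOn (Φ j) (Set.Icc a b) := by
    intro j
    induction j with
    | zero => 
      exact (aux_cont_mulVec hMc continuousOn_const).congr (fun x _ => hΦ0 x)
    | succ j ih =>
      refine (aux_cont_mulVec hMc ?_).congr (fun x _ => hrec j x)
      exact fun x hx =>
        (aux_deriv_integral hx₀ (aux_cont_mulVec hGc ih) hx).continuousWithinAt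
  set S : ℕ → ℝ → (Fin n → ℝ) := fun l x => ∑ j ∈ Finset.range (l + 1), Φ j x with hS
  have hSc : ∀ l, ContinuousOn (S l) (Set.Icc a b) := fun l =>
    continuousOn_finsetSum _ (fun j _ => hΦc j)
  have hΦtc : ContinuousOn Φt (Set.Icc a b) :=
    hconv.continuousOn (Filter.Frequently.of_forall hSc)
  have hint : ∀ {f : ℝ → Fin n → ℝ}, ContinuousOn f (Set.Icc a b) → ∀ x ∈ Set.Icc a b,
      IntervalIntegrable (fun t => G t *ᵥ f t) MeasureTheory.volume x₀ x := fun hf x hx =>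
    ((aux_cont_mulVec hGc hf).mono (Set.uIcc_subset_Icc hx₀ hx)).intervalIntegrable
  have hSrec : ∀ l, ∀ x ∈ Set.Icc a b,
      S (l + 1) x = M x *ᵥ (c + ∫ t in x₀..x, G t *ᵥ S l t) := by
    intro l x hx
    have h1 : (∫ t in x₀..x, G t *ᵥ S l t)
        = ∑ j ∈ Finset.range (l + 1), ∫ t in x₀..x, G t *ᵥ Φ j t := by
      rw [← intervalIntegral.integral_finsetSum (fun j _ => hint (hΦc j) x hx)]
      simp only [hS, Matrix.mulVec_sum]
    rw [h1, Matrix.mulVec_add, Matrix.mulVec_sum]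
    simp only [hS]
    rw [Finset.sum_range_succ', hΦ0, add_comm]
    simp only [hrec]
  obtain ⟨C, hC⟩ := isCompact_Icc.exists_bound_of_continuousOn hGc
  obtain ⟨K, hK⟩ := isCompact_Icc.exists_bound_of_continuousOn hΦtc
  have hfix : ∀ x ∈ Set.Icc a b, Φt x = M x *ᵥ (c + ∫ t in x₀..x, G t *ᵥ Φt t) := by
    intro x hx
    have hsub : Set.uIoc x₀ x ⊆ Set.Icc a b :=
      Set.uIoc_subset_uIcc.trans (Set.uIcc_subset_Icc hx₀ hx)
    have hI : Filter.Tendsto (fun l => ∫ t in x₀..x, G t *ᵥ S l t) Filter.atTop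
        (nhds (∫ t in x₀..x, G t *ᵥ Φt t)) := by
      apply intervalIntegral.tendsto_integral_filter_of_dominated_convergence
        (fun _ => n * C * (K + 1))
      · exact Filter.Eventually.of_forall fun l =>
          (intervalIntegrable_iff.1 (hint (hSc l) x hx)).aestronglyMeasurable
      · filter_upwards [Metric.tendstoUniformlyOn_iff.1 hconv 1 one_pos] with l hl
        refine Filter.Eventually.of_forall fun t ht => ?_
        have ht' := hsub ht
        have h1 : ‖S l t‖ ≤ K + 1 := by
          have h2 := hl t ht'
          rw [dist_comm, dist_eq_norm] at h2
          have h3 := norm_le_norm_add_norm_sub' (S l t) (Φt t)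
          have h4 := hK t ht'
          have h5 : ‖S l t - Φt t‖ < 1 := h2
          linarith
        have hC0 := (norm_nonneg _).trans (hC t ht')
        refine (aux_norm_mulVec _ _).trans ?_
        have := hC t ht'
        gcongr
      · exact intervalIntegrable_const
      · refine Filter.Eventually.of_forall fun t ht => ?_
        have h1 := hconv.tendsto_at (hsub ht)
        exact ((continuous_const.matrix_mulVec continuous_id).tendsto (Φt t)).comp h1
    have h2 : Filter.Tendsto (fun l => S (l + 1) x) Filter.atTop (nhds (Φt x)) :=
      (hconv.tendsto_at hx).comp (Filter.tendsto_add_atTop_nat 1)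
    have h3 : Filter.Tendsto (fun l => S (l + 1) x) Filter.atTop
        (nhds (M x *ᵥ (c + ∫ t in x₀..x, G t *ᵥ Φt t))) := by
      simp only [hSrec _ x hx]
      exact ((continuous_const.matrix_mulVec (continuous_const.add continuous_id)).tendsto
        (∫ t in x₀..x, G t *ᵥ Φt t)).comp hI
    exact tendsto_nhds_unique h2 h3
  intro x hx
  have hd := aux_deriv_mulVec (hM x hx)
    ((aux_deriv_integral hx₀ (aux_cont_mulVec hGc hΦtc) hx).const_add c)
  have hd2 := hd.congr (fun y hy => hfix y hy) (hfix x hx)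
  have hu := (Matrix.isUnit_iff_isUnit_det _).1 (hMinv x hx)
  have key : (H x + Z x) *ᵥ Φt x = (H x * M x) *ᵥ (c + ∫ t in x₀..x, G t *ᵥ Φt t)
      + M x *ᵥ (G x *ᵥ Φt x) := by
    rw [Matrix.add_mulVec, ← Matrix.mulVec_mulVec, ← hfix x hx]
    congr 1
    simp only [hG]
    rw [Matrix.mulVec_mulVec, ← Matrix.mul_assoc, Matrix.mul_nonsing_inv _ hu, Matrix.one_mul]
  rw [key]
  exact hd2
end

section
/- Let n ≥ 1, let [a,b] be a real interval, let H, Z : ℝ → Matrix (Fin n) (Fin n) ℝ be continuous on [a,b], let F : ℝ → (Fin n → ℝ) be continuous on [a,b], and let M : ℝ → Matrix (Fin n) (Fin n) ℝ be differentiable on [a,b] with M'(x) = H(x) * M(x) and M(x) invertible for every x ∈ [a,b]. Fix x₀ ∈ [a,b] and a constant vector c ∈ (Fin n → ℝ), and define Φ̄_j : ℝ → (Fin n → ℝ) recursively by Φ̄_0(x) = M(x) ·ᵥ c + M(x) ·ᵥ ∫_{x₀}^{x} (M(t))⁻¹ ·ᵥ F(t) dt and Φ̄_{j+1}(x) = M(x)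 ·ᵥ ∫_{x₀}^{x} (M(t))⁻¹ ·ᵥ (Z(t) ·ᵥ Φ̄_j(t)) dt. If the partial sums Σ_{j=0}^{l} Φ̄_j converge uniformly on [a,b] to a function Φ̄ : ℝ → (Fin n → ℝ), then Φ̄ is differentiable on [a,b] and Φ̄'(x) = (H(x) + Z(x)) ·ᵥ Φ̄(x) + F(x) for all x ∈ [a,b]. -/
open Matrix

attribute [local instance] Matrix.normedAddCommGroup Matrix.normedSpace

theorem mulVec_hasDeriv_aux {n : ℕ} {M : ℝ → Matrix (Fin n) (Fin n) ℝ}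
    {M' : Matrix (Fin n) (Fin n) ℝ} {u : ℝ → Fin n → ℝ} {u' : Fin n → ℝ} {s : Set ℝ} {x : ℝ}
    (hM : HasDerivWithinAt M M' s x) (hu : HasDerivWithinAt u u' s x) :
    HasDerivWithinAt (fun y => M y *ᵥ u y) (M' *ᵥ u x + M x *ᵥ u') s x := by
  have hMij : ∀ i j, HasDerivWithinAt (fun y => M y i j) (M' i j) s x := fun i j =>
    hasDerivWithinAt_pi.1 (hasDerivWithinAt_pi.1 hM i) j
  have huj := hasDerivWithinAt_pi.1 hu
  rw [hasDerivWithinAt_pi]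
  intro i
  have h := HasDerivWithinAt.fun_sum (u := Finset.univ) (fun j _ => (hMij i j).mul (huj j))
  simp only [Finset.sum_add_distrib] at h
  exact h

theorem mulVec_continuousOn_aux {n : ℕ} {X : Type*} [TopologicalSpace X]
    {A : X → Matrix (Fin n) (Fin n) ℝ}
    {u : X → Fin n → ℝ} {s : Set X} (hA : ContinuousOn A s) (hu : ContinuousOn u s) :
    ContinuousOn (fun y => A y *ᵥ u y) s := by
  rw [continuousOn_iff_continuous_restrict] at *
  exact hA.matrix_mulVec hu

theorem inv_continuousOn_aux {n : ℕ} {A : ℝ → Matrix (Fin n) (Fin n) ℝ} {s : Set ℝ}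
    (hA : ContinuousOn A s) (hu : ∀ x ∈ s, IsUnit (A x)) :
    ContinuousOn (fun y => (A y)⁻¹) s := by
  rw [continuousOn_iff_continuous_restrict] at *
  have h1 : Continuous fun y : s => (A y).adjugate := Continuous.matrix_adjugate hA
  have h2 : Continuous fun y : s => (A y).det := Continuous.matrix_det hA
  have h3 : Continuous fun y : s => ((A y).det)⁻¹ := h2.inv₀ (fun y =>
    ((Matrix.isUnit_iff_isUnit_det _).1 (hu y y.2)).ne_zero)
  have h4 := h3.smul h1
  refine h4.congr fun y => ?_
  simp [Set.restrict, Matrix.inv_def]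

theorem integral_hasDeriv_aux {n : ℕ} {g : ℝ → Fin n → ℝ} {a b x₀ x : ℝ}
    (hg : ContinuousOn g (Set.Icc a b)) (hx₀ : x₀ ∈ Set.Icc a b) (hx : x ∈ Set.Icc a b) :
    HasDerivWithinAt (fun y => ∫ t in x₀..y, g t) (g x) (Set.Icc a b) x := by
  haveI : Fact (x ∈ Set.Icc a b) := ⟨hx⟩
  exact intervalIntegral.integral_hasDerivWithinAt_right
    (hg.mono (Set.uIcc_subset_Icc hx₀ hx)).intervalIntegrable
    (hg.stronglyMeasurableAtFilter_nhdsWithin measurableSet_Icc x) (hg x hx)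

/-- If `M` is a fundamental matrix of `y' = H(x) y` on `[a,b]`, the special series for
the nonhomogeneous equation has first term
`Φ̄₀(x) = M(x) c + M(x) ·ᵥ ∫_{x₀}^{x} M(t)⁻¹ ·ᵥ F(t) dt` and subsequent terms
`Φ̄_{j+1}(x) = M(x) ·ᵥ ∫_{x₀}^{x} M(t)⁻¹ ·ᵥ (Z(t) ·ᵥ Φ̄_j(t)) dt`, and the partial sums
`∑_{j=0}^{l} Φ̄_j` converge uniformly on `[a,b]` to `Φb`, then `Φb` is differentiable
on `[a,b]` and solves the nonhomogeneous equation `Φb' = (H + Z) Φb + F` there. -/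
theorem special_series_solution_nonhomogeneous
    (n : ℕ) (hn : 1 ≤ n) (a b : ℝ)
    (H Z : ℝ → Matrix (Fin n) (Fin n) ℝ)
    (hH : ContinuousOn H (Set.Icc a b))
    (hZ : ContinuousOn Z (Set.Icc a b))
    (F : ℝ → (Fin n → ℝ))
    (hF : ContinuousOn F (Set.Icc a b))
    (M : ℝ → Matrix (Fin n) (Fin n) ℝ)
    (hM : ∀ x ∈ Set.Icc a b, HasDerivWithinAt M (H x * M x) (Set.Icc a b) x)
    (hMinv : ∀ x ∈ Set.Icc a b, IsUnit (M x))
    (x₀ : ℝ) (hx₀ : x₀ ∈ Set.Icc a b)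
    (c : Fin n → ℝ)
    (Φ : ℕ → ℝ → (Fin n → ℝ))
    (hΦ0 : ∀ x : ℝ, Φ 0 x = M x *ᵥ c + M x *ᵥ ∫ t in x₀..x, (M t)⁻¹ *ᵥ F t)
    (hΦrec : ∀ (j : ℕ) (x : ℝ),
      Φ (j + 1) x = M x *ᵥ ∫ t in x₀..x, (M t)⁻¹ *ᵥ (Z t *ᵥ Φ j t))
    (Φb : ℝ → (Fin n → ℝ))
    (hconv : TendstoUniformlyOn
      (fun l x => ∑ j ∈ Finset.range (l + 1), Φ j x) Φb Filter.atTop (Set.Icc a b)) :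
    ∀ x ∈ Set.Icc a b,
      HasDerivWithinAt Φb ((H x + Z x) *ᵥ Φb x + F x) (Set.Icc a b) x := by
  set S := Set.Icc a b with hS
  have hMc : ContinuousOn M S := fun x hx => (hM x hx).continuousWithinAt
  have hIc : ContinuousOn (fun y => (M y)⁻¹) S := inv_continuousOn_aux hMc hMinv
  have hgF : ContinuousOn (fun t => (M t)⁻¹ *ᵥ F t) S := mulVec_continuousOn_aux hIc hF
  have hgen : ∀ u : ℝ → Fin n → ℝ, ContinuousOn u S →
      ContinuousOn (fun t => (M t)⁻¹ *ᵥ (Z t *ᵥ u t)) S := fun u hu =>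
    mulVec_continuousOn_aux hIc (mulVec_continuousOn_aux hZ hu)
  have hint : ∀ g : ℝ → Fin n → ℝ, ContinuousOn g S →
      ContinuousOn (fun y => ∫ t in x₀..y, g t) S := fun g hg x hx =>
    (integral_hasDeriv_aux hg hx₀ hx).continuousWithinAt
  have hii : ∀ g : ℝ → Fin n → ℝ, ContinuousOn g S → ∀ x ∈ S,
      IntervalIntegrable g MeasureTheory.volume x₀ x := fun g hg x hx =>
    (hg.mono (Set.uIcc_subset_Icc hx₀ hx)).intervalIntegrable
  have hΦc : ∀ j, ContinuousOn (Φ j) S := by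
    intro j
    induction j with
    | zero =>
      rw [show Φ 0 = _ from funext hΦ0]
      exact (mulVec_continuousOn_aux hMc continuousOn_const).add
        (mulVec_continuousOn_aux hMc (hint _ hgF))
    | succ j ih =>
      rw [show Φ (j + 1) = _ from funext (hΦrec j)]
      exact mulVec_continuousOn_aux hMc (hint _ (hgen _ ih))
  have hSc : ∀ l, ContinuousOn (fun x => ∑ j ∈ Finset.range l, Φ j x) S := fun l =>
    continuousOn_finsetSum _ fun j _ => hΦc j
  have hbc : ContinuousOn Φb S :=
    hconv.continuousOn (Filter.Frequently.of_forall fun l => hSc (l + 1))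
  have hsum : ∀ l, ∀ x ∈ S, ∑ j ∈ Finset.range (l + 1), Φ j x =
      M x *ᵥ (c + (∫ t in x₀..x, (M t)⁻¹ *ᵥ F t) +
        ∫ t in x₀..x, (M t)⁻¹ *ᵥ (Z t *ᵥ ∑ j ∈ Finset.range l, Φ j t)) := by
    intro l x hx
    induction l with
    | zero => simp [hΦ0, Matrix.mulVec_add]
    | succ l ih =>
      rw [Finset.sum_range_succ, ih, hΦrec, ← Matrix.mulVec_add, add_assoc,
        ← intervalIntegral.integral_add (hii _ (hgen _ (hSc l)) x hx)
          (hii _ (hgen _ (hΦc l)) x hx)]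
      simp only [Finset.sum_range_succ _ l, Matrix.mulVec_add]
  -- uniform bound
  obtain ⟨C, hC⟩ := (isCompact_Icc (a := a) (b := b)).exists_bound_of_continuousOn hbc
  have hK : ContinuousOn (fun p : ℝ × (Fin n → ℝ) => (M p.1)⁻¹ *ᵥ (Z p.1 *ᵥ p.2))
      (S ×ˢ Metric.closedBall 0 (C + 1)) := by
    have hfst : Set.MapsTo (Prod.fst : ℝ × (Fin n → ℝ) → ℝ)
      (S ×ˢ Metric.closedBall 0 (C + 1)) S := fun p hp => hp.1
    exact mulVec_continuousOn_aux (hIc.comp continuousOn_fst hfst)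
      (mulVec_continuousOn_aux (hZ.comp continuousOn_fst hfst) continuousOn_snd)
  obtain ⟨B, hB⟩ := ((isCompact_Icc (a := a) (b := b)).prod
    (isCompact_closedBall (0 : Fin n → ℝ) (C + 1))).exists_bound_of_continuousOn hK
  have hlim : ∀ x ∈ S, Filter.Tendsto
      (fun l => ∫ t in x₀..x, (M t)⁻¹ *ᵥ (Z t *ᵥ ∑ j ∈ Finset.range (l + 1), Φ j t))
      Filter.atTop (nhds (∫ t in x₀..x, (M t)⁻¹ *ᵥ (Z t *ᵥ Φb t))) := by
    intro x hx
    have hsub : Set.uIoc x₀ x ⊆ S := Set.uIoc_subset_uIcc.trans (Set.uIcc_subset_Icc hx₀ hx)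
    refine intervalIntegral.tendsto_integral_filter_of_dominated_convergence (fun _ => B)
      ?_ ?_ ?_ ?_
    · exact Filter.Eventually.of_forall fun l =>
        ((hgen _ (hSc (l + 1))).mono hsub).aestronglyMeasurable measurableSet_uIoc
    · filter_upwards [Metric.tendstoUniformlyOn_iff.1 hconv 1 one_pos] with l hl
      refine Filter.Eventually.of_forall fun t ht => ?_
      refine hB (t, ∑ j ∈ Finset.range (l + 1), Φ j t) ⟨hsub ht, ?_⟩
      have h1 := hl t (hsub ht)
      have h2 := hC t (hsub ht)
      rw [dist_comm, dist_eq_norm] at h1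
      rw [mem_closedBall_zero_iff]
      have h3 := norm_le_norm_add_norm_sub' (∑ j ∈ Finset.range (l + 1), Φ j t) (Φb t)
      linarith
    · exact intervalIntegrable_const
    · refine Filter.Eventually.of_forall fun t ht => ?_
      have hc : Continuous fun v : Fin n → ℝ => (M t)⁻¹ *ᵥ (Z t *ᵥ v) :=
        continuous_const.matrix_mulVec (continuous_const.matrix_mulVec continuous_id)
      exact (hc.tendsto (Φb t)).comp (hconv.tendsto_at (hsub ht))
  have hfix : ∀ x ∈ S, Φb x = M x *ᵥ (c + (∫ t in x₀..x, (M t)⁻¹ *ᵥ F t) +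
      ∫ t in x₀..x, (M t)⁻¹ *ᵥ (Z t *ᵥ Φb t)) := by
    intro x hx
    have h1 := (hconv.tendsto_at hx).comp (Filter.tendsto_add_atTop_nat 1)
    have hc : Continuous fun v : Fin n → ℝ => M x *ᵥ
        (c + (∫ t in x₀..x, (M t)⁻¹ *ᵥ F t) + v) :=
      continuous_const.matrix_mulVec (continuous_const.add continuous_id)
    have h2 := (hc.tendsto _).comp (hlim x hx)
    refine tendsto_nhds_unique h1 (h2.congr fun l => ?_)
    exact (hsum (l + 1) x hx).symm
  intro x hx
  have hd := mulVec_hasDeriv_aux (hM x hx)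
    (((integral_hasDeriv_aux hgF hx₀ hx).const_add c).add
      (integral_hasDeriv_aux (hgen _ hbc) hx₀ hx))
  have hd2 := hd.congr hfix (hfix x hx)
  refine hd2.congr_deriv ?_
  have hdet := (Matrix.isUnit_iff_isUnit_det _).1 (hMinv x hx)
  have e1 := hfix x hx
  simp only [Pi.add_apply]
  rw [← Matrix.mulVec_mulVec, ← e1, Matrix.mulVec_add, Matrix.mulVec_mulVec,
    Matrix.mulVec_mulVec, Matrix.mul_nonsing_inv _ hdet, Matrix.one_mulVec, Matrix.one_mulVec,
    Matrix.add_mulVec]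
  abel
end

section
/- Define M : ℝ → Matrix (Fin 2) (Fin 2) ℝ by M(x) = !![3·exp x, exp (-x); -exp x, -exp (-x)] and Z : ℝ → Matrix (Fin 2) (Fin 2) ℝ by Z(x) = !![exp (-2x) - 3·exp (2x), exp (-2x) - 9·exp (2x); exp (2x) - exp (-2x), 3·exp (2x) - exp (-2x)]. Fix constants c₁, c₂ ∈ ℝ and define Φ_j : ℝ → (Fin 2 → ℝ) recursively by Φ_0(x) = M(x) ·ᵥ (c₁, c₂) and Φ_{j+1}(x) = M(x) ·ᵥ ∫_{0}^{x} (M(t))⁻¹ ·ᵥ (Z(t) ·ᵥ Φ_j(t)) dt. Then for every j ≥ 0 and every real x: if j is even, Φ_j(x) = M(x) ·ᵥ (((2x)^j / j!)·c₁, ((2x)^j / j!)·c₂), and if j is odd, Φ_j(x) = M(x) ·ᵥ (((2x)^j / j!)·c₂, ((2x)^j / j!)·c₁). -/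
open Matrix

lemma aux_integral (j : ℕ) (a b x : ℝ) :
    (∫ t in (0 : ℝ)..x, (![2 * ((2 * t) ^ j / (Nat.factorial j : ℝ) * a),
        2 * ((2 * t) ^ j / (Nat.factorial j : ℝ) * b)] : Fin 2 → ℝ)) =
      ![(2 * x) ^ (j + 1) / (Nat.factorial (j + 1) : ℝ) * a,
        (2 * x) ^ (j + 1) / (Nat.factorial (j + 1) : ℝ) * b] := by
  have hf : (Nat.factorial j : ℝ) ≠ 0 := by positivity
  have hj : (j : ℝ) + 1 ≠ 0 := by positivity
  have key : ∀ c t : ℝ, HasDerivAt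
      (fun t : ℝ => (2 * t) ^ (j + 1) / (Nat.factorial (j + 1) : ℝ) * c)
      (2 * ((2 * t) ^ j / (Nat.factorial j : ℝ) * c)) t := by
    intro c t
    have h1 : HasDerivAt (fun t : ℝ => 2 * t) 2 t := by
      simpa using (hasDerivAt_id t).const_mul (2 : ℝ)
    have h2 := ((h1.pow (j + 1)).div_const (Nat.factorial (j + 1) : ℝ)).mul_const c
    refine h2.congr_deriv ?_
    rw [Nat.factorial_succ]
    push_cast
    field_simp
  rw [intervalIntegral.integral_eq_sub_of_hasDerivAt
    (f := fun t : ℝ => (![(2 * t) ^ (j + 1) / (Nat.factorial (j + 1) : ℝ) * a,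
        (2 * t) ^ (j + 1) / (Nat.factorial (j + 1) : ℝ) * b] : Fin 2 → ℝ))]
  · ext i
    fin_cases i <;> simp
  · intro t _
    rw [hasDerivAt_pi]
    intro i
    fin_cases i
    · exact key a t
    · exact key b t
  · apply Continuous.intervalIntegrable
    refine continuous_pi fun i => ?_
    fin_cases i
    · show Continuous fun t : ℝ => 2 * ((2 * t) ^ j / (Nat.factorial j : ℝ) * a)
      fun_prop
    · show Continuous fun t : ℝ => 2 * ((2 * t) ^ j / (Nat.factorial j : ℝ) * b)
      fun_prop

/-- In the illustrative example, the terms of the special series, defined by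
`Φ₀(x) = M(x) ·ᵥ (c₁, c₂)` and
`Φ_{j+1}(x) = M(x) ·ᵥ ∫_0^x M(t)⁻¹ ·ᵥ (Z(t) ·ᵥ Φ_j(t)) dt`, are
`Φ_j(x) = M(x) ·ᵥ ((2x)^j/j! · c₁, (2x)^j/j! · c₂)` for even `j` and
`Φ_j(x) = M(x) ·ᵥ ((2x)^j/j! · c₂, (2x)^j/j! · c₁)` for odd `j`. -/
theorem example_special_series_terms
    (M Z : ℝ → Matrix (Fin 2) (Fin 2) ℝ)
    (hM : ∀ x : ℝ,
      M x = !![3 * Real.exp x, Real.exp (-x); -Real.exp x, -Real.exp (-x)])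
    (hZ : ∀ x : ℝ,
      Z x = !![Real.exp (-(2 * x)) - 3 * Real.exp (2 * x),
                 Real.exp (-(2 * x)) - 9 * Real.exp (2 * x);
               Real.exp (2 * x) - Real.exp (-(2 * x)),
                 3 * Real.exp (2 * x) - Real.exp (-(2 * x))])
    (c₁ c₂ : ℝ)
    (Φ : ℕ → ℝ → (Fin 2 → ℝ))
    (hΦ0 : ∀ x : ℝ, Φ 0 x = M x *ᵥ ![c₁, c₂])
    (hΦrec : ∀ (j : ℕ) (x : ℝ),
      Φ (j + 1) x = M x *ᵥ ∫ t in (0 : ℝ)..x, (M t)⁻¹ *ᵥ (Z t *ᵥ Φ j t)) :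
    ∀ (j : ℕ) (x : ℝ),
      (Even j →
        Φ j x = M x *ᵥ ![(2 * x) ^ j / (Nat.factorial j : ℝ) * c₁,
                          (2 * x) ^ j / (Nat.factorial j : ℝ) * c₂]) ∧
      (Odd j →
        Φ j x = M x *ᵥ ![(2 * x) ^ j / (Nat.factorial j : ℝ) * c₂,
                          (2 * x) ^ j / (Nat.factorial j : ℝ) * c₁]) := by
  have hstep : ∀ t a b : ℝ, (M t)⁻¹ *ᵥ (Z t *ᵥ (M t *ᵥ ![a, b])) = ![2 * b, 2 * a] := by
    intro t a b
    have hE : Real.exp t * Real.exp (-t) = 1 := by rw [← Real.exp_add]; simp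
    have h2 : Real.exp (2 * t) = Real.exp t ^ 2 := by rw [← Real.exp_nat_mul]; norm_num
    have h3 : Real.exp (-(2 * t)) = Real.exp (-t) ^ 2 := by
      rw [← Real.exp_nat_mul]; congr 1; push_cast; ring
    have hdet : IsUnit (M t).det := by
      have : (M t).det = -2 := by
        rw [hM, Matrix.det_fin_two_of]
        linear_combination (-2) * hE
      rw [this]
      exact isUnit_iff_ne_zero.mpr (by norm_num)
    have hZM : Z t *ᵥ (M t *ᵥ ![a, b]) = M t *ᵥ ![2 * b, 2 * a] := by
      rw [hM, hZ, h2, h3]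
      generalize Real.exp t = p at *
      generalize Real.exp (-t) = q at *
      ext i
      fin_cases i
      · simp [Matrix.mulVec, dotProduct, Fin.sum_univ_two]
        linear_combination (2 * a * q + 6 * b * p) * hE
      · simp [Matrix.mulVec, dotProduct, Fin.sum_univ_two]
        linear_combination (-2 * a * q - 2 * b * p) * hE
    rw [hZM, Matrix.mulVec_mulVec, Matrix.nonsing_inv_mul _ hdet, Matrix.one_mulVec]
  intro j
  induction j with
  | zero =>
    intro x
    refine ⟨fun _ => ?_, fun h => ?_⟩
    · simp [hΦ0]
    · simp at h
  | succ j ih =>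
    intro x
    refine ⟨fun h => ?_, fun h => ?_⟩
    · have hj : Odd j := by
        rcases Nat.even_or_odd j with h' | h'
        · exact absurd h (Nat.not_even_iff_odd.mpr h'.add_one)
        · exact h'
      rw [hΦrec]
      simp only [(ih _).2 hj, hstep]
      rw [aux_integral]
    · have hj : Even j := by
        rcases Nat.even_or_odd j with h' | h'
        · exact h'
        · exact absurd h (Nat.not_odd_iff_even.mpr h'.add_one)
      rw [hΦrec]
      simp only [(ih _).1 hj, hstep]
      rw [aux_integral]
end
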